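/- arXiv:1407.0597 — 5 statements merged into one kernel-verified Lean document; each statement's English description precedes it below -/
import Mathlib

section
/- Fix d ∈ ℝᵐ and assume μ({p : r(d,p) = α_β(d)}) = 0 (the distribution of r(d,·) under μ has no atom at the value-at-risk). Then the conditional value-at-risk equals the minimum of R_β over α, i.e. φ_β(d) = min_{α ∈ ℝ} R_β(α,d), and the minimum is attained at α = α_β(d). -/
open MeasureTheory

/-- The distribution function takes the value `β` at its `β`-quantile, if there is no atom there. -/
theorem cdf_sInf_eq_of_measure_singleton_eq_zero (ν : Measure ℝ) [IsProbabilityMeasure ν] {β : ℝ}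
    (hβ : β ∈ Set.Ioo (0 : ℝ) 1)
    (hν : ν {sInf {α : ℝ | β ≤ ProbabilityTheory.cdf ν α}} = 0) :
    ProbabilityTheory.cdf ν (sInf {α : ℝ | β ≤ ProbabilityTheory.cdf ν α}) = β := by
  set F := ProbabilityTheory.cdf ν
  set S := {α : ℝ | β ≤ F α}
  have hne : S.Nonempty :=
    ((ProbabilityTheory.tendsto_cdf_atTop ν).eventually (lt_mem_nhds hβ.2)).exists.imp
      fun _ h ↦ le_of_lt h
  have hbdd : BddBelow S := by
    obtain ⟨a, ha⟩ :=
      ((ProbabilityTheory.tendsto_cdf_atBot ν).eventually (gt_mem_nhds hβ.1)).exists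
    refine ⟨a, fun x hx ↦ ?_⟩
    by_contra! hxa
    exact absurd (le_trans hx (F.mono hxa.le)) (not_le.2 ha)
  have hge : β ≤ F (sInf S) := by
    have h : Filter.Tendsto F (nhdsWithin (sInf S) (Set.Ioi (sInf S))) (nhds (F (sInf S))) :=
      (F.right_continuous (sInf S)).tendsto.mono_left
        (nhdsWithin_mono _ Set.Ioi_subset_Ici_self)
    refine ge_of_tendsto h (eventually_nhdsWithin_of_forall fun a ha ↦ ?_)
    obtain ⟨s, hs, hsa⟩ := exists_lt_of_csInf_lt hne ha
    exact le_trans hs (F.mono hsa.le)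
  have hleft : Function.leftLim F (sInf S) ≤ β := by
    refine le_of_tendsto (F.mono.tendsto_leftLim (sInf S))
      (eventually_nhdsWithin_of_forall fun a ha ↦ ?_)
    by_contra! h
    exact absurd (csInf_le hbdd h.le) (not_le.2 ha)
  rw [← ProbabilityTheory.measure_cdf ν, StieltjesFunction.measure_singleton,
    ENNReal.ofReal_eq_zero] at hν
  linarith

/-- With `μ` a Borel probability measure on `ℝⁿ` with compact support `D`,
`β ∈ (0,1)`, `r` continuous in `p` for each `d`, the distribution function
`Ψ d α = μ {p | r d p ≤ α}`, the value-at-risk `VaR d = inf {α | Ψ d α ≥ β}`, the conditional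
value-at-risk `CVaR d = (1/(1-β)) ∫_{r(d,p) ≥ VaR d} r d p dμ`, and the auxiliary function
`R α d = α + (1/(1-β)) ∫ max (r d p - α) 0 dμ`: if the distribution of `r d ·` has no atom at
the value-at-risk, then `CVaR d = min_α R α d`, with the minimum attained at `α = VaR d`. -/
theorem stmt_0 (m n : ℕ) (μ : Measure (Fin n → ℝ)) [IsProbabilityMeasure μ]
    (D : Set (Fin n → ℝ)) (hD : IsCompact D) (hμD : μ D = 1)
    (β : ℝ) (hβ : β ∈ Set.Ioo (0 : ℝ) 1)
    (r : (Fin m → ℝ) → (Fin n → ℝ) → ℝ) (hr : ∀ d, Continuous (r d))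
    (Ψ : (Fin m → ℝ) → ℝ → ℝ)
    (hΨ : ∀ d α, Ψ d α = (μ {p | r d p ≤ α}).toReal)
    (VaR : (Fin m → ℝ) → ℝ)
    (hVaR : ∀ d, VaR d = sInf {α : ℝ | β ≤ Ψ d α})
    (CVaR : (Fin m → ℝ) → ℝ)
    (hCVaR : ∀ d, CVaR d = (1 / (1 - β)) * ∫ p in {p | VaR d ≤ r d p}, r d p ∂μ)
    (R : ℝ → (Fin m → ℝ) → ℝ)
    (hR : ∀ α d, R α d = α + (1 / (1 - β)) * ∫ p, max (r d p - α) 0 ∂μ)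
    (d : Fin m → ℝ)
    (hatom : μ {p | r d p = VaR d} = 0) :
    CVaR d = R (VaR d) d ∧ ∀ α : ℝ, R (VaR d) d ≤ R α d := by
  have hβ1 : 0 < 1 - β := sub_pos.2 hβ.2
  have hm : Measurable (r d) := (hr d).measurable
  have hDae : ∀ᵐ p ∂μ, p ∈ D := (mem_ae_iff_prob_eq_one hD.measurableSet).2 hμD
  have hint : Integrable (r d) μ := by
    rw [← Measure.restrict_eq_self_of_ae_mem hDae]
    exact (hr d).continuousOn.integrableOn_compact hD
  have : IsProbabilityMeasure (μ.map (r d)) := Measure.isProbabilityMeasure_map hm.aemeasurable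
  have hcdf (α : ℝ) : ProbabilityTheory.cdf (μ.map (r d)) α = Ψ d α := by
    rw [ProbabilityTheory.cdf_eq_real, measureReal_def, Measure.map_apply hm measurableSet_Iic, hΨ]
    rfl
  have hv : VaR d = sInf {α : ℝ | β ≤ ProbabilityTheory.cdf (μ.map (r d)) α} := by
    simp_rw [hcdf, hVaR]
  have hΨv : Ψ d (VaR d) = β := by
    rw [← hcdf, hv]
    refine cdf_sInf_eq_of_measure_singleton_eq_zero _ hβ ?_
    rw [← hv, Measure.map_apply hm (measurableSet_singleton _)]
    exact hatom
  set A : Set (Fin n → ℝ) := {p | VaR d ≤ r d p}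
  have hAm : MeasurableSet A := measurableSet_le measurable_const hm
  have hμA : μ.real A = 1 - β := by
    have hae : A =ᵐ[μ] ({p | r d p ≤ VaR d}ᶜ : Set (Fin n → ℝ)) := by
      have h : ∀ᵐ p ∂μ, r d p ≠ VaR d := by
        rw [ae_iff]
        simpa using hatom
      filter_upwards [h] with p hp
      apply propext
      change VaR d ≤ r d p ↔ ¬ r d p ≤ VaR d
      rw [not_le]
      exact ⟨fun h ↦ lt_of_le_of_ne h hp.symm, le_of_lt⟩
    rw [measureReal_congr hae, probReal_compl_eq_one_sub (measurableSet_le hm measurable_const),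
      measureReal_def, ← hΨ, hΨv]
  have hsub (α : ℝ) : CVaR d = α + (1 / (1 - β)) * ∫ p in A, (r d p - α) ∂μ := by
    rw [hCVaR, integral_sub hint.integrableOn (integrable_const _), setIntegral_const, hμA,
      smul_eq_mul]
    field_simp
    ring
  have hmax (α : ℝ) : Integrable (fun p ↦ max (r d p - α) 0) μ :=
    (hint.sub (integrable_const α)).pos_part
  have heq : CVaR d = R (VaR d) d := by
    rw [hsub (VaR d), hR, ← integral_indicator hAm]
    congr 3
    ext p
    by_cases hp : p ∈ A
    · rw [Set.indicator_of_mem hp, max_eq_left (sub_nonneg.2 hp)]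
    · rw [Set.indicator_of_notMem hp, max_eq_right (sub_nonpos.2 (le_of_not_ge hp))]
  refine ⟨heq, fun α ↦ ?_⟩
  rw [← heq, hsub α, hR]
  gcongr
  calc ∫ p in A, (r d p - α) ∂μ ≤ ∫ p in A, max (r d p - α) 0 ∂μ :=
        setIntegral_mono (hint.sub (integrable_const α)).integrableOn (hmax α).integrableOn
          fun p ↦ le_max_left _ _
    _ ≤ ∫ p, max (r d p - α) 0 ∂μ :=
        setIntegral_le_integral (hmax α) (.of_forall fun p ↦ le_max_right _ _)
end

section
/- Fix d ∈ ℝᵐ and assume that the distribution of r(d,·) under μ is atomless, i.e. μ({p : r(d,p) = α}) = 0 for every α ∈ ℝ. Then the function α ↦ R_β(α,d) is continuously differentiable on ℝ with derivative (d/dα) R_β(α,d) = 1 − (1 − Ψ(d,α))/(1−β). -/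
open MeasureTheory

/-- A continuous real-valued function is integrable if some compact set has full measure. -/
theorem integrable_of_continuous_of_compact_full {X : Type*} [TopologicalSpace X] [T2Space X]
    [MeasurableSpace X] [OpensMeasurableSpace X] {μ : Measure X} [IsProbabilityMeasure μ]
    {D : Set X} (hD : IsCompact D) (hμD : μ D = 1) {f : X → ℝ} (hf : Continuous f) :
    Integrable f μ := by
  obtain ⟨C, hC⟩ := hD.exists_bound_of_continuousOn hf.continuousOn
  have hae : ∀ᵐ x ∂μ, x ∈ D := mem_ae_iff.2 ((prob_compl_eq_zero_iff hD.measurableSet).2 hμD)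
  exact Integrable.of_bound hf.measurable.aestronglyMeasurable C (hae.mono hC)

section Distribution

variable {Ω : Type*} [MeasurableSpace Ω] {μ : Measure Ω} {f : Ω → ℝ}

theorem ae_ne_of_measure_level_eq_zero {α : ℝ} (h : μ {x | f x = α} = 0) :
    ∀ᵐ x ∂μ, f x ≠ α := by
  simpa [ae_iff] using h

variable [IsProbabilityMeasure μ]

theorem integral_ite_le_sub_one (hf : Measurable f) (α : ℝ) :
    ∫ x, (if f x ≤ α then (0 : ℝ) else -1) ∂μ = (μ {x | f x ≤ α}).toReal - 1 := by
  have hm : MeasurableSet {x | f x ≤ α} := measurableSet_le hf measurable_const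
  have heq : (fun x => if f x ≤ α then (0 : ℝ) else -1) =
      fun x => {x | f x ≤ α}.indicator (fun _ => (1 : ℝ)) x - 1 := by
    funext x
    by_cases hx : f x ≤ α <;> simp [hx]
  rw [heq, integral_sub ((integrable_const (1 : ℝ)).indicator hm) (integrable_const _),
    integral_indicator_const _ hm]
  simp [Measure.real]

open Filter in
/-- If `f` does not charge the level `α`, the mean excess over `α` is differentiable there. -/
theorem hasDerivAt_integral_max_sub (hf : Measurable f) (hint : Integrable f μ) {α : ℝ}
    (h : μ {x | f x = α} = 0) :
    HasDerivAt (fun a => ∫ x, max (f x - a) 0 ∂μ) ((μ {x | f x ≤ α}).toReal - 1) α := by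
  rw [← integral_ite_le_sub_one hf]
  refine (hasDerivAt_integral_of_dominated_loc_of_lip (bound := fun _ => 1) univ_mem
    (Eventually.of_forall fun a => ?_) ?_ ?_ (Eventually.of_forall fun x => ?_)
    (integrable_const _) ?_).2
  · exact ((hf.sub_const a).max measurable_const).aestronglyMeasurable
  · exact (hint.sub (integrable_const α)).pos_part
  · exact (Measurable.ite (measurableSet_le hf measurable_const) measurable_const
      measurable_const).aestronglyMeasurable
  · refine LipschitzOnWith.of_dist_le_mul fun a _ b _ => ?_
    simp only [Real.nnabs_of_nonneg zero_le_one, Real.toNNReal_one, NNReal.coe_one, one_mul,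
      Real.dist_eq]
    refine (abs_max_sub_max_le_abs _ _ _).trans ?_
    rw [sub_sub_sub_cancel_left, abs_sub_comm]
  · filter_upwards [ae_ne_of_measure_level_eq_zero h] with x hx
    rcases hx.lt_or_gt with hx | hx
    · rw [if_pos hx.le]
      refine (hasDerivAt_const α (0 : ℝ)).congr_of_eventuallyEq ?_
      filter_upwards [lt_mem_nhds hx] with a ha
      exact max_eq_right (sub_nonpos.2 ha.le)
    · rw [if_neg hx.not_ge]
      refine ((hasDerivAt_id α).const_sub (f x)).congr_of_eventuallyEq ?_
      filter_upwards [gt_mem_nhds hx] with a ha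
      exact max_eq_left (sub_nonneg.2 ha.le)

open Filter in
theorem continuous_measure_sublevel (hf : Measurable f) (h : ∀ α, μ {x | f x = α} = 0) :
    Continuous fun α => (μ {x | f x ≤ α}).toReal := by
  have key : Continuous fun α => ∫ x, (if f x ≤ α then (0 : ℝ) else -1) ∂μ := by
    refine continuous_iff_continuousAt.2 fun α => ?_
    refine continuousAt_of_dominated (bound := fun _ => 1) (Eventually.of_forall fun a => ?_)
      (Eventually.of_forall fun a => Eventually.of_forall fun x => ?_) (integrable_const _) ?_
    · exact (Measurable.ite (measurableSet_le hf measurable_const) measurable_const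
        measurable_const).aestronglyMeasurable
    · split_ifs <;> simp
    · filter_upwards [ae_ne_of_measure_level_eq_zero (h α)] with x hx
      rcases hx.lt_or_gt with hx | hx
      · refine (continuousAt_const (y := (0 : ℝ))).congr ?_
        filter_upwards [lt_mem_nhds hx] with a ha
        exact (if_pos ha.le).symm
      · refine (continuousAt_const (y := (-1 : ℝ))).congr ?_
        filter_upwards [gt_mem_nhds hx] with a ha
        exact (if_neg ha.not_ge).symm
  simp only [integral_ite_le_sub_one hf] at key
  simpa using key.add_const 1

end Distribution

/-- Fix `d` and assume the distribution of `r d ·` under `μ` is atomless,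
i.e. `μ {p | r d p = α} = 0` for every `α`. Then `α ↦ R α d` is continuously differentiable
on `ℝ` with derivative `1 - (1 - Ψ d α)/(1 - β)`. -/
theorem stmt_2 (m n : ℕ) (μ : Measure (Fin n → ℝ)) [IsProbabilityMeasure μ]
    (D : Set (Fin n → ℝ)) (hD : IsCompact D) (hμD : μ D = 1)
    (β : ℝ) (hβ : β ∈ Set.Ioo (0 : ℝ) 1)
    (r : (Fin m → ℝ) → (Fin n → ℝ) → ℝ) (hr : ∀ d, Continuous (r d))
    (Ψ : (Fin m → ℝ) → ℝ → ℝ)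
    (hΨ : ∀ d α, Ψ d α = (μ {p | r d p ≤ α}).toReal)
    (R : ℝ → (Fin m → ℝ) → ℝ)
    (hR : ∀ α d, R α d = α + (1 / (1 - β)) * ∫ p, max (r d p - α) 0 ∂μ)
    (d : Fin m → ℝ)
    (hatomless : ∀ α : ℝ, μ {p | r d p = α} = 0) :
    (∀ α : ℝ, HasDerivAt (fun a : ℝ => R a d) (1 - (1 - Ψ d α) / (1 - β)) α) ∧
      Continuous (fun α : ℝ => 1 - (1 - Ψ d α) / (1 - β)) := by
  simp only [hΨ, hR]
  have hm : Measurable (r d) := (hr d).measurable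
  refine ⟨fun α => ?_, ?_⟩
  · refine ((hasDerivAt_id α).add ((hasDerivAt_integral_max_sub hm
      (integrable_of_continuous_of_compact_full hD hμD (hr d)) (hatomless α)).const_mul
      (1 / (1 - β)))).congr_deriv ?_
    ring
  · have := continuous_measure_sublevel hm hatomless
    fun_prop
end

section
/- For every fixed d ∈ ℝᵐ, the value-at-risk α_β(d) is a minimizer of the function α ↦ R_β(α,d) over ℝ, and it is the least element of the set of minimizers: every α ∈ ℝ with R_β(α,d) = inf_{α'} R_β(α',d) satisfies α ≥ α_β(d). -/
open MeasureTheory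

section ValueAtRisk

variable {Ω : Type*} [MeasurableSpace Ω] {μ : Measure Ω} [IsProbabilityMeasure μ] {X : Ω → ℝ}

theorem integrable_max_sub_zero (hX : Integrable X μ) (a : ℝ) :
    Integrable (fun ω => max (X ω - a) 0) μ :=
  (hX.sub (integrable_const a)).pos_part

theorem integral_const_mul_indicator_lt (hm : Measurable X) (a c : ℝ) :
    ∫ ω, {ω | a < X ω}.indicator (fun _ => c) ω ∂μ = c * (1 - μ.real {ω | X ω ≤ a}) := by
  have hs : MeasurableSet {ω | X ω ≤ a} := measurableSet_le hm measurable_const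
  have hc : {ω | a < X ω} = {ω | X ω ≤ a}ᶜ := by ext; simp
  rw [hc, integral_indicator_const _ hs.compl, probReal_compl_eq_one_sub hs, smul_eq_mul, mul_comm]

theorem integral_max_sub_le_of_le (hm : Measurable X) (hX : Integrable X μ) {a b : ℝ}
    (hab : a ≤ b) :
    ∫ ω, max (X ω - a) 0 ∂μ ≤
      ∫ ω, max (X ω - b) 0 ∂μ + (b - a) * (1 - μ.real {ω | X ω ≤ a}) := by
  have hi : Integrable ({ω | a < X ω}.indicator fun _ => b - a) μ :=
    (integrable_const _).indicator (measurableSet_lt measurable_const hm)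
  rw [← integral_const_mul_indicator_lt hm, ← integral_add (integrable_max_sub_zero hX b) hi]
  refine integral_mono (integrable_max_sub_zero hX a) ((integrable_max_sub_zero hX b).add hi)
    fun ω => ?_
  simp only [Set.indicator_apply, Set.mem_ofPred_eq]
  grind

theorem le_integral_max_sub_of_le (hm : Measurable X) (hX : Integrable X μ) {a b : ℝ}
    (hab : a ≤ b) :
    ∫ ω, max (X ω - b) 0 ∂μ + (b - a) * (1 - μ.real {ω | X ω ≤ b}) ≤
      ∫ ω, max (X ω - a) 0 ∂μ := by
  have hi : Integrable ({ω | b < X ω}.indicator fun _ => b - a) μ :=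
    (integrable_const _).indicator (measurableSet_lt measurable_const hm)
  rw [← integral_const_mul_indicator_lt hm, ← integral_add (integrable_max_sub_zero hX b) hi]
  refine integral_mono ((integrable_max_sub_zero hX b).add hi) (integrable_max_sub_zero hX a)
    fun ω => ?_
  simp only [Set.indicator_apply, Set.mem_ofPred_eq]
  grind

theorem continuous_integral_max_sub (hX : Integrable X μ) :
    Continuous fun a => ∫ ω, max (X ω - a) 0 ∂μ := by
  refine (LipschitzWith.of_le_add fun a b => ?_).continuous
  rw [← sub_le_iff_le_add', ← integral_sub (integrable_max_sub_zero hX a)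
    (integrable_max_sub_zero hX b)]
  calc ∫ ω, (max (X ω - a) 0 - max (X ω - b) 0) ∂μ ≤ ∫ _, dist a b ∂μ := by
        refine integral_mono ((integrable_max_sub_zero hX a).sub (integrable_max_sub_zero hX b))
          (integrable_const _) fun ω => ?_
        simp only [Real.dist_eq]
        grind
    _ = dist a b := by simp

theorem nonempty_setOf_le_measureReal_le (hm : Measurable X) {β : ℝ} (hβ : β < 1) :
    {a | β ≤ μ.real {ω | X ω ≤ a}}.Nonempty := by
  have := Measure.isProbabilityMeasure_map (μ := μ) hm.aemeasurable
  obtain ⟨a, ha⟩ :=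
    ((ProbabilityTheory.tendsto_cdf_atTop (μ.map X)).eventually_const_lt hβ).exists
  rw [ProbabilityTheory.cdf_eq_real, map_measureReal_apply hm measurableSet_Iic] at ha
  exact ⟨a, ha.le⟩

theorem bddBelow_setOf_le_measureReal_le (hm : Measurable X) {β : ℝ} (hβ : 0 < β) :
    BddBelow {a | β ≤ μ.real {ω | X ω ≤ a}} := by
  have := Measure.isProbabilityMeasure_map (μ := μ) hm.aemeasurable
  obtain ⟨b, hb⟩ :=
    ((ProbabilityTheory.tendsto_cdf_atBot (μ.map X)).eventually_lt_const hβ).exists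
  rw [ProbabilityTheory.cdf_eq_real, map_measureReal_apply hm measurableSet_Iic] at hb
  refine ⟨b, fun a ha => le_of_not_gt fun hab => ?_⟩
  exact absurd (ha.trans (measureReal_mono fun ω hω => le_trans hω hab.le)) hb.not_ge

variable (μ X) in
/-- The auxiliary function whose minimum over `a` is the conditional value-at-risk of `X`. -/
noncomputable def cvarAux (β a : ℝ) : ℝ :=
  a + (1 / (1 - β)) * ∫ ω, max (X ω - a) 0 ∂μ

theorem continuous_cvarAux (hX : Integrable X μ) (β : ℝ) : Continuous (cvarAux μ X β) :=
  continuous_id.add ((continuous_integral_max_sub hX).const_mul _)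

theorem cvarAux_le_of_le (hm : Measurable X) (hX : Integrable X μ) {β a b : ℝ} (hβ : β < 1)
    (hab : a ≤ b) (ha : β ≤ μ.real {ω | X ω ≤ a}) : cvarAux μ X β a ≤ cvarAux μ X β b := by
  have hβ' : 0 < 1 - β := sub_pos.2 hβ
  have h := integral_max_sub_le_of_le hm hX hab
  have h' : (b - a) * (1 - μ.real {ω | X ω ≤ a}) ≤ (b - a) * (1 - β) :=
    mul_le_mul_of_nonneg_left (by linarith) (sub_nonneg.2 hab)
  have := mul_le_mul_of_nonneg_left (h.trans (add_le_add_right h' _)) (one_div_pos.2 hβ').le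
  rw [mul_add, show 1 / (1 - β) * ((b - a) * (1 - β)) = b - a by field_simp] at this
  unfold cvarAux
  linarith

theorem cvarAux_lt_of_lt (hm : Measurable X) (hX : Integrable X μ) {β a b : ℝ} (hβ : β < 1)
    (hab : a < b) (hb : μ.real {ω | X ω ≤ b} < β) : cvarAux μ X β b < cvarAux μ X β a := by
  have hβ' : 0 < 1 - β := sub_pos.2 hβ
  have h := le_integral_max_sub_of_le hm hX hab.le
  have h' : (b - a) * (1 - β) < (b - a) * (1 - μ.real {ω | X ω ≤ b}) :=
    mul_lt_mul_of_pos_left (by linarith) (sub_pos.2 hab)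
  have := mul_lt_mul_of_pos_left ((add_lt_add_right h' _).trans_le h) (one_div_pos.2 hβ')
  rw [mul_add, show 1 / (1 - β) * ((b - a) * (1 - β)) = b - a by field_simp] at this
  unfold cvarAux
  linarith

theorem le_measureReal_of_sInf_lt (hm : Measurable X) {β a : ℝ} (hβ : β < 1)
    (ha : sInf {a | β ≤ μ.real {ω | X ω ≤ a}} < a) : β ≤ μ.real {ω | X ω ≤ a} := by
  obtain ⟨s, hs, hsa⟩ := exists_lt_of_csInf_lt (nonempty_setOf_le_measureReal_le hm hβ) ha
  exact le_trans hs (measureReal_mono fun ω hω => le_trans hω hsa.le)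

theorem measureReal_lt_of_lt_sInf (hm : Measurable X) {β a : ℝ} (hβ : 0 < β)
    (ha : a < sInf {a | β ≤ μ.real {ω | X ω ≤ a}}) : μ.real {ω | X ω ≤ a} < β :=
  not_le.1 fun h => ha.not_ge (csInf_le (bddBelow_setOf_le_measureReal_le hm hβ) h)

theorem cvarAux_sInf_le (hm : Measurable X) (hX : Integrable X μ) {β : ℝ}
    (hβ : β ∈ Set.Ioo (0 : ℝ) 1) (a : ℝ) :
    cvarAux μ X β (sInf {a | β ≤ μ.real {ω | X ω ≤ a}}) ≤ cvarAux μ X β a := by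
  have hc := continuous_cvarAux hX β
  set v := sInf {a | β ≤ μ.real {ω | X ω ≤ a}} with hv
  rcases lt_trichotomy a v with h | h | h
  · refine le_of_tendsto (hc.continuousWithinAt (s := Set.Iio v) (x := v)) ?_
    filter_upwards [Ioo_mem_nhdsLT h] with b hb
    exact (cvarAux_lt_of_lt hm hX hβ.2 hb.1 (measureReal_lt_of_lt_sInf hm hβ.1 hb.2)).le
  · rw [h]
  · refine le_of_tendsto (hc.continuousWithinAt (s := Set.Ioi v) (x := v)) ?_
    filter_upwards [Ioo_mem_nhdsGT h] with b hb
    exact cvarAux_le_of_le hm hX hβ.2 hb.2.le (le_measureReal_of_sInf_lt hm hβ.2 hb.1)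

theorem sInf_le_of_forall_cvarAux_le (hm : Measurable X) (hX : Integrable X μ) {β a : ℝ}
    (hβ : β ∈ Set.Ioo (0 : ℝ) 1) (ha : ∀ b, cvarAux μ X β a ≤ cvarAux μ X β b) :
    sInf {a | β ≤ μ.real {ω | X ω ≤ a}} ≤ a := by
  by_contra! h
  obtain ⟨b, hab, hb⟩ := exists_between h
  exact (ha b).not_gt (cvarAux_lt_of_lt hm hX hβ.2 hab (measureReal_lt_of_lt_sInf hm hβ.1 hb))

end ValueAtRisk

theorem Continuous.integrable_of_isCompact_of_measure_eq_one {E : Type*} [TopologicalSpace E]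
    [T2Space E] [MeasurableSpace E] [BorelSpace E] {μ : Measure E} [IsProbabilityMeasure μ]
    {D : Set E} (hD : IsCompact D) (hμD : μ D = 1) {f : E → ℝ} (hf : Continuous f) :
    Integrable f μ := by
  have h : ∀ᵐ p ∂μ, p ∈ D := (prob_compl_eq_zero_iff hD.isClosed.measurableSet).2 hμD
  rw [← Measure.restrict_eq_self_of_ae_mem h]
  exact hf.continuousOn.integrableOn_compact hD

/-- For every fixed `d`, the value-at-risk `VaR d` is a minimizer of
`α ↦ R α d` over `ℝ`, and it is the least element of the set of minimizers: every `α` with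
`R α d = ⨅ α', R α' d` satisfies `α ≥ VaR d`. -/
theorem stmt_3 (m n : ℕ) (μ : Measure (Fin n → ℝ)) [IsProbabilityMeasure μ]
    (D : Set (Fin n → ℝ)) (hD : IsCompact D) (hμD : μ D = 1)
    (β : ℝ) (hβ : β ∈ Set.Ioo (0 : ℝ) 1)
    (r : (Fin m → ℝ) → (Fin n → ℝ) → ℝ) (hr : ∀ d, Continuous (r d))
    (Ψ : (Fin m → ℝ) → ℝ → ℝ)
    (hΨ : ∀ d α, Ψ d α = (μ {p | r d p ≤ α}).toReal)
    (VaR : (Fin m → ℝ) → ℝ)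
    (hVaR : ∀ d, VaR d = sInf {α : ℝ | β ≤ Ψ d α})
    (R : ℝ → (Fin m → ℝ) → ℝ)
    (hR : ∀ α d, R α d = α + (1 / (1 - β)) * ∫ p, max (r d p - α) 0 ∂μ)
    (d : Fin m → ℝ) :
    (∀ α : ℝ, R (VaR d) d ≤ R α d) ∧
      (∀ α : ℝ, R α d = (⨅ α' : ℝ, R α' d) → VaR d ≤ α) := by
  have hm : Measurable (r d) := (hr d).measurable
  have hX : Integrable (r d) μ := (hr d).integrable_of_isCompact_of_measure_eq_one hD hμD
  have hRd : ∀ α, R α d = cvarAux μ (r d) β α := fun α => hR α d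
  have hv : VaR d = sInf {α | β ≤ μ.real {p | r d p ≤ α}} := by
    simp only [hVaR, hΨ, measureReal_def]
  simp only [hRd, hv]
  refine ⟨cvarAux_sInf_le hm hX hβ, fun α hα => sInf_le_of_forall_cvarAux_le hm hX hβ fun b => ?_⟩
  rw [hα]
  exact ciInf_le ⟨_, Set.forall_mem_range.2 (cvarAux_sInf_le hm hX hβ)⟩ b
end

section
/- If for every p in the support D of μ the map d ↦ r(d,p) is convex on ℝᵐ, then the function (α, d) ↦ R_β(α,d) is jointly convex on ℝ × ℝᵐ. -/
open MeasureTheory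

/-- A continuous function is integrable for a finite measure carried by a compact set. -/
theorem Continuous.integrable_of_ae_mem_isCompact {X E : Type*} [TopologicalSpace X] [T2Space X]
    [MeasurableSpace X] [OpensMeasurableSpace X] [NormedAddCommGroup E]
    [SecondCountableTopologyEither X E] {μ : Measure X} [IsFiniteMeasure μ] {K : Set X}
    (hK : IsCompact K) (hμK : ∀ᵐ x ∂μ, x ∈ K) {f : X → E} (hf : Continuous f) :
    Integrable f μ := by
  rw [← Measure.restrict_eq_self_of_ae_mem hμK]
  exact hf.continuousOn.integrableOn_compact' hK hK.measurableSet

/-- An integral of functions that are almost all convex is convex. -/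
theorem ConvexOn.integral_of_ae {X E : Type*} [MeasurableSpace X] {μ : Measure X}
    [AddCommGroup E] [Module ℝ E] {s : Set E} (hs : Convex ℝ s) {f : E → X → ℝ}
    (hint : ∀ x ∈ s, Integrable (f x) μ) (hf : ∀ᵐ p ∂μ, ConvexOn ℝ s fun x => f x p) :
    ConvexOn ℝ s fun x => ∫ p, f x p ∂μ := by
  refine ⟨hs, fun x hx y hy a b ha hb hab => ?_⟩
  have hxi := (hint x hx).const_mul a
  have hyi := (hint y hy).const_mul b
  simp only [smul_eq_mul]
  rw [← integral_const_mul, ← integral_const_mul, ← integral_add hxi hyi]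
  refine integral_mono_ae (hint _ (hs hx hy ha hb hab)) (hxi.add hyi) ?_
  filter_upwards [hf] with p hp
  exact hp.2 hx hy ha hb hab

/-- If for every `p` in the support `D` of `μ` the map `d ↦ r d p` is convex
on `ℝᵐ`, then `(α, d) ↦ R α d` is jointly convex on `ℝ × ℝᵐ`. -/
theorem stmt_4 (m n : ℕ) (μ : Measure (Fin n → ℝ)) [IsProbabilityMeasure μ]
    (D : Set (Fin n → ℝ)) (hD : IsCompact D) (hμD : μ D = 1)
    (β : ℝ) (hβ : β ∈ Set.Ioo (0 : ℝ) 1)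
    (r : (Fin m → ℝ) → (Fin n → ℝ) → ℝ) (hr : ∀ d, Continuous (r d))
    (R : ℝ → (Fin m → ℝ) → ℝ)
    (hR : ∀ α d, R α d = α + (1 / (1 - β)) * ∫ p, max (r d p - α) 0 ∂μ)
    (hconv : ∀ p ∈ D, ConvexOn ℝ Set.univ (fun d : Fin m → ℝ => r d p)) :
    ConvexOn ℝ Set.univ (fun x : ℝ × (Fin m → ℝ) => R x.1 x.2) := by
  have hae : ∀ᵐ p ∂μ, p ∈ D := (mem_ae_iff_prob_eq_one hD.measurableSet).2 hμD
  have hfst : ConvexOn ℝ Set.univ (fun x : ℝ × (Fin m → ℝ) => x.1) :=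
    (LinearMap.fst ℝ ℝ (Fin m → ℝ)).convexOn convex_univ
  have hfst' : ConcaveOn ℝ Set.univ (fun x : ℝ × (Fin m → ℝ) => x.1) :=
    (LinearMap.fst ℝ ℝ (Fin m → ℝ)).concaveOn convex_univ
  have hint : ConvexOn ℝ Set.univ
      (fun x : ℝ × (Fin m → ℝ) => ∫ p, max (r x.2 p - x.1) 0 ∂μ) := by
    refine ConvexOn.integral_of_ae convex_univ (fun x _ => ?_) ?_
    · exact (((hr x.2).sub continuous_const).max continuous_const).integrable_of_ae_mem_isCompact
        hD hae
    · filter_upwards [hae] with p hp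
      exact (((hconv p hp).comp_linearMap (LinearMap.snd ℝ ℝ (Fin m → ℝ))).sub hfst').sup
        (convexOn_const 0 convex_univ)
  have hcoef : 0 ≤ 1 / (1 - β) := one_div_nonneg.2 (sub_nonneg.2 hβ.2.le)
  simp only [hR]
  exact hfst.add (hint.smul hcoef)
end

section
/- Fix real numbers P_av ≥ 0, S ≥ 0, and θ ∈ (0, π/2). The inverter operating region F^{OID} := { (P_c, Q_c) ∈ ℝ² : 0 ≤ P_c ≤ P_av, Q_c² ≤ S² − (P_av − P_c)², |Q_c| ≤ tan(θ) · (P_av − P_c) } is a convex subset of ℝ². -/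
/-- Fix `P_av ≥ 0`, `S ≥ 0`, and `θ ∈ (0, π/2)`. The inverter operating
region `{(P_c, Q_c) : 0 ≤ P_c ≤ P_av, Q_c² ≤ S² − (P_av − P_c)², |Q_c| ≤ tan θ (P_av − P_c)}`
is a convex subset of `ℝ²`. -/
theorem stmt_18 (Pav S θ : ℝ) (hPav : 0 ≤ Pav) (hS : 0 ≤ S)
    (hθ : θ ∈ Set.Ioo (0 : ℝ) (Real.pi / 2)) :
    Convex ℝ {pq : ℝ × ℝ |
      0 ≤ pq.1 ∧ pq.1 ≤ Pav ∧
      pq.2 ^ 2 ≤ S ^ 2 - (Pav - pq.1) ^ 2 ∧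
      |pq.2| ≤ Real.tan θ * (Pav - pq.1)} := by
  rintro ⟨p, q⟩ ⟨h1, h2, h3, h4⟩ ⟨p', q'⟩ ⟨k1, k2, k3, k4⟩ a b ha hb hab
  obtain rfl : b = 1 - a := by linarith
  simp only [Set.mem_ofPred_eq, Prod.smul_mk, Prod.mk_add_mk, smul_eq_mul] at *
  rw [abs_le] at h4 k4 ⊢
  refine ⟨by positivity, ?_, ?_, ?_, ?_⟩
  · linarith [mul_le_mul_of_nonneg_left h2 ha, mul_le_mul_of_nonneg_left k2 hb]
  · linarith [mul_le_mul_of_nonneg_left h3 ha, mul_le_mul_of_nonneg_left k3 hb,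
      mul_nonneg (mul_nonneg ha hb) (add_nonneg (sq_nonneg (q - q')) (sq_nonneg (p - p')))]
  · linarith [mul_le_mul_of_nonneg_left h4.1 ha, mul_le_mul_of_nonneg_left k4.1 hb]
  · linarith [mul_le_mul_of_nonneg_left h4.2 ha, mul_le_mul_of_nonneg_left k4.2 hb]
end
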